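/- The four matrices Z1, Z2, Z3, Z4 are linearly independent over ℂ and form a basis of the commutant {S,T}′ = {X ∈ M₁₀(ℂ) : XS = SX and XT = TX}. -/

import Mathlib

open Matrix Complex

noncomputable section

/-- d = 1 + √3 -/
def dd : ℂ := 1 + Real.sqrt 3

/-- L = 2 + d² = 6 + 2√3 -/
def LL : ℂ := 6 + 2 * Real.sqrt 3

/-- The S-matrix of the modular data of the quantum double of the even E6 system. -/
def S : Matrix (Fin 10) (Fin 10) ℂ := LL⁻¹ •
  !![1,    1,    1+dd, 1+dd, 2+dd,  dd,   dd,    dd,          dd,          dd;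
     1,    1,    1+dd, 1+dd, -2-dd, dd,   dd,    -dd,         -dd,         -dd;
     1+dd, 1+dd, 1,    1,    2+dd,  -dd,  -dd,   -dd,         -dd,         -dd;
     1+dd, 1+dd, 1,    1,    -2-dd, -dd,  -dd,   dd,          dd,          dd;
     2+dd, -2-dd,2+dd, -2-dd,0,     0,    0,     0,           0,           0;
     dd,   dd,   -dd,  -dd,  0,     dd,   dd,    -dd,         -dd,         2*dd;
     dd,   dd,   -dd,  -dd,  0,     dd,   dd,    -dd,         -dd,         -2*dd;
     dd,   -dd,  -dd,  dd,   0,     -dd,  dd,    -(2+dd)*I,   (2+dd)*I,    0;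
     dd,   -dd,  -dd,  dd,   0,     -dd,  dd,    (2+dd)*I,    -(2+dd)*I,   0;
     dd,   -dd,  -dd,  dd,   0,     2*dd, -2*dd, 0,           0,           0]

/-- The T-matrix: diag(1,−1,1,−1,1,e^{πi/3},e^{4πi/3},e^{5πi/6},e^{5πi/6},−i). -/
def T : Matrix (Fin 10) (Fin 10) ℂ := Matrix.diagonal
  ![1, -1, 1, -1, 1,
    Complex.exp (Real.pi * I / 3), Complex.exp (4 * Real.pi * I / 3),
    Complex.exp (5 * Real.pi * I / 6), Complex.exp (5 * Real.pi * I / 6), -I]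

/-- Z1: the identity modular invariant. -/
def Z1 : Matrix (Fin 10) (Fin 10) ℂ := 1

/-- Z2: the permutation matrix of the transposition (7 8). -/
def Z2 : Matrix (Fin 10) (Fin 10) ℂ := Matrix.of fun μ ν =>
  if (μ = 7 ∧ ν = 8) ∨ (μ = 8 ∧ ν = 7) then 1
  else if μ = ν ∧ μ ≠ 7 ∧ μ ≠ 8 then 1 else 0

/-- Z3. -/
def Z3 : Matrix (Fin 10) (Fin 10) ℂ := Matrix.of fun μ ν =>
  if (μ = 0 ∨ μ = 2) ∧ (ν = 0 ∨ ν = 2) then 1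
  else if (μ = 1 ∨ μ = 3) ∧ (ν = 1 ∨ ν = 3) then 1
  else if μ = 4 ∧ ν = 4 then 2 else 0

/-- Z4. -/
def Z4 : Matrix (Fin 10) (Fin 10) ℂ := Matrix.of fun μ ν =>
  if (μ = 0 ∨ μ = 2 ∨ μ = 4) ∧ (ν = 0 ∨ ν = 2 ∨ ν = 4) then 1 else 0

/-- The commutant {S,T}′ as a complex subspace of the 10×10 matrices. -/
def Comm : Submodule ℂ (Matrix (Fin 10) (Fin 10) ℂ) where
  carrier := {X | X * S = S * X ∧ X * T = T * X}
  add_mem' := by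
    rintro a b ⟨ha1, ha2⟩ ⟨hb1, hb2⟩
    constructor <;> simp [add_mul, mul_add, ha1, ha2, hb1, hb2]
  zero_mem' := by simp
  smul_mem' := by
    rintro c a ⟨ha1, ha2⟩
    constructor <;> simp [Matrix.smul_mul, Matrix.mul_smul, ha1, ha2]

/-- The matrix `L • S`. -/
def unscaledS : Matrix (Fin 10) (Fin 10) ℂ :=
  !![1,    1,    1+dd, 1+dd, 2+dd,  dd,   dd,    dd,          dd,          dd;
     1,    1,    1+dd, 1+dd, -2-dd, dd,   dd,    -dd,         -dd,         -dd;
     1+dd, 1+dd, 1,    1,    2+dd,  -dd,  -dd,   -dd,         -dd,         -dd;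
     1+dd, 1+dd, 1,    1,    -2-dd, -dd,  -dd,   dd,          dd,          dd;
     2+dd, -2-dd,2+dd, -2-dd,0,     0,    0,     0,           0,           0;
     dd,   dd,   -dd,  -dd,  0,     dd,   dd,    -dd,         -dd,         2*dd;
     dd,   dd,   -dd,  -dd,  0,     dd,   dd,    -dd,         -dd,         -2*dd;
     dd,   -dd,  -dd,  dd,   0,     -dd,  dd,    -(2+dd)*I,   (2+dd)*I,    0;
     dd,   -dd,  -dd,  dd,   0,     -dd,  dd,    (2+dd)*I,    -(2+dd)*I,   0;
     dd,   -dd,  -dd,  dd,   0,     2*dd, -2*dd, 0,           0,           0]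

lemma dd_eq_ofReal : dd = ((1 + √3 : ℝ) : ℂ) := by simp [dd]

lemma dd_ne_zero : dd ≠ 0 := by
  rw [dd_eq_ofReal, ofReal_ne_zero]
  positivity

lemma two_add_dd_ne_zero : 2 + dd ≠ 0 := by
  have h : 2 + dd = ((2 + (1 + √3) : ℝ) : ℂ) := by rw [dd_eq_ofReal]; push_cast; rfl
  rw [h, ofReal_ne_zero]
  positivity

lemma LL_ne_zero : LL ≠ 0 := by
  have h : LL = ((6 + 2 * √3 : ℝ) : ℂ) := by simp [LL]
  rw [h, ofReal_ne_zero]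
  positivity

lemma commute_S_iff (X : Matrix (Fin 10) (Fin 10) ℂ) :
    X * S = S * X ↔ X * unscaledS = unscaledS * X := by
  change X * (LL⁻¹ • unscaledS) = (LL⁻¹ • unscaledS) * X ↔ _
  rw [Matrix.mul_smul, Matrix.smul_mul]
  exact (smul_right_injective _ (inv_ne_zero LL_ne_zero)).eq_iff

/-- The eigenspace of `T` containing each basis vector, numbered by increasing real part of
the eigenvalue. -/
def eigenBlock : Fin 10 → Fin 6 := ![5, 0, 5, 0, 5, 4, 2, 1, 1, 3]

/-- The eigenvalues of `T`, by increasing real part. -/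
def eigenvalue : Fin 6 → ℂ :=
  ![-1, exp (5 * Real.pi * I / 6), exp (4 * Real.pi * I / 3), -I, exp (Real.pi * I / 3), 1]

lemma T_eq_diagonal : T = diagonal (eigenvalue ∘ eigenBlock) := by
  rw [T]
  congr 1
  ext i
  fin_cases i <;> rfl

lemma exp_re_of_eq_ofReal_mul_I {z : ℂ} (x : ℝ) (h : z = x * I) : (exp z).re = Real.cos x := by
  rw [h, exp_ofReal_mul_I_re]

lemma eigenvalue_re (k : Fin 6) :
    (eigenvalue k).re = ![-1, -(√3 / 2), -(1 / 2), 0, 1 / 2, 1] k := by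
  have h₁ : (exp (5 * Real.pi * I / 6)).re = -(√3 / 2) := by
    rw [exp_re_of_eq_ofReal_mul_I (Real.pi - Real.pi / 6) (by push_cast; ring), Real.cos_pi_sub,
      Real.cos_pi_div_six]
  have h₂ : (exp (4 * Real.pi * I / 3)).re = -(1 / 2) := by
    rw [exp_re_of_eq_ofReal_mul_I (Real.pi / 3 + Real.pi) (by push_cast; ring), Real.cos_add_pi,
      Real.cos_pi_div_three]
  have h₃ : (exp (Real.pi * I / 3)).re = 1 / 2 := by
    rw [exp_re_of_eq_ofReal_mul_I (Real.pi / 3) (by push_cast; ring), Real.cos_pi_div_three]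
  fin_cases k
  · simp [eigenvalue]
  · exact h₁
  · exact h₂
  · simp [eigenvalue]
  · exact h₃
  · simp [eigenvalue]

lemma eigenvalue_injective : Function.Injective eigenvalue := by
  have hlt : √3 < 2 := by rw [Real.sqrt_lt' two_pos]; norm_num
  have hgt : 1 < √3 := by rw [Real.lt_sqrt one_pos.le]; norm_num
  have hmono : StrictMono fun k => (eigenvalue k).re := by
    rw [Fin.strictMono_iff_lt_succ]
    intro k
    simp only [eigenvalue_re]
    fin_cases k <;> simp <;> linarith
  exact fun k l h => hmono.injective (congrArg re h)

lemma commute_T_iff (X : Matrix (Fin 10) (Fin 10) ℂ) :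
    X * T = T * X ↔ ∀ μ ν, eigenBlock μ ≠ eigenBlock ν → X μ ν = 0 := by
  simp only [← Matrix.ext_iff, T_eq_diagonal, mul_diagonal, diagonal_mul, Function.comp_apply]
  refine forall₂_congr fun μ ν => ?_
  rw [mul_comm, ← sub_eq_zero, ← sub_mul, mul_eq_zero, sub_eq_zero, eigenvalue_injective.eq_iff,
    or_iff_not_imp_left, eq_comm]

lemma mem_Comm_iff (X : Matrix (Fin 10) (Fin 10) ℂ) :
    X ∈ Comm ↔ X * unscaledS = unscaledS * X ∧
      ∀ μ ν, eigenBlock μ ≠ eigenBlock ν → X μ ν = 0 := by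
  rw [← commute_S_iff, ← commute_T_iff]
  rfl

lemma Z1_mem_Comm : Z1 ∈ Comm := by
  rw [mem_Comm_iff, Z1]
  exact ⟨by simp, fun μ ν h => one_apply_ne (ne_of_apply_ne _ h)⟩

set_option maxHeartbeats 1000000 in
lemma Z2_mem_Comm : Z2 ∈ Comm := by
  rw [mem_Comm_iff]
  constructor
  · ext i j
    fin_cases i <;> fin_cases j <;> simp [Matrix.mul_apply, Fin.sum_univ_succ, Z2, unscaledS]
  · intro μ ν h
    rw [Z2, of_apply, if_neg (by decide +revert), if_neg (by decide +revert)]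

set_option maxHeartbeats 1000000 in
lemma Z3_mem_Comm : Z3 ∈ Comm := by
  rw [mem_Comm_iff]
  constructor
  · ext i j
    fin_cases i <;> fin_cases j <;>
      simp [Matrix.mul_apply, Fin.sum_univ_succ, Z3, unscaledS] <;> ring
  · intro μ ν h
    rw [Z3, of_apply, if_neg (by decide +revert), if_neg (by decide +revert), if_neg (by decide +revert)]

set_option maxHeartbeats 1000000 in
lemma Z4_mem_Comm : Z4 ∈ Comm := by
  rw [mem_Comm_iff]
  constructor
  · ext i j
    fin_cases i <;> fin_cases j <;>
      simp [Matrix.mul_apply, Fin.sum_univ_succ, Z4, unscaledS] <;> ring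
  · intro μ ν h
    rw [Z4, of_apply, if_neg (by decide +revert)]

lemma eq_combination_of_mem_Comm {X : Matrix (Fin 10) (Fin 10) ℂ} (hX : X ∈ Comm) :
    X = X 7 7 • Z1 + X 7 8 • Z2 + X 1 3 • Z3 + X 0 4 • Z4 := by
  obtain ⟨hS, hT⟩ := (mem_Comm_iff X).1 hX
  have hd := dd_ne_zero
  have hd2 := two_add_dd_ne_zero
  have entry (i j : Fin 10) : ∑ k, X i k * unscaledS k j = ∑ k, unscaledS i k * X k j := by
    simpa only [Matrix.mul_apply] using congrFun₂ hS i j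
  have h55 : X 5 5 = X 9 9 := by
    have h := entry 5 9
    simp [Fin.sum_univ_succ, unscaledS] at h
    simp (discharger := decide) only [hT] at h
    refine mul_left_cancel₀ hd ?_
    linear_combination (1 / 2) * h
  have h66 : X 6 6 = X 9 9 := by
    have h := entry 6 9
    simp [Fin.sum_univ_succ, unscaledS] at h
    simp (discharger := decide) only [hT] at h
    refine mul_left_cancel₀ hd ?_
    linear_combination -(1 / 2) * h
  have hrow7 : X 7 7 + X 7 8 = X 5 5 := by
    have h := entry 7 5
    simp [Fin.sum_univ_succ, unscaledS] at h
    simp (discharger := decide) only [hT] at h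
    refine mul_left_cancel₀ hd ?_
    linear_combination -h
  have hrow8 : X 8 7 + X 8 8 = X 5 5 := by
    have h := entry 8 5
    simp [Fin.sum_univ_succ, unscaledS] at h
    simp (discharger := decide) only [hT] at h
    refine mul_left_cancel₀ hd ?_
    linear_combination -h
  have hcol7 : X 7 7 + X 8 7 = X 5 5 := by
    have h := entry 5 7
    simp [Fin.sum_univ_succ, unscaledS] at h
    simp (discharger := decide) only [hT] at h
    refine mul_left_cancel₀ hd ?_
    linear_combination h
  have h11 : X 1 1 - X 1 3 = X 9 9 := by
    have h := entry 1 9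
    simp [Fin.sum_univ_succ, unscaledS] at h
    simp (discharger := decide) only [hT] at h
    refine mul_left_cancel₀ hd ?_
    linear_combination -h
  have h33 : X 3 3 - X 3 1 = X 9 9 := by
    have h := entry 3 9
    simp [Fin.sum_univ_succ, unscaledS] at h
    simp (discharger := decide) only [hT] at h
    refine mul_left_cancel₀ hd ?_
    linear_combination h
  have h31 : X 1 1 - X 3 1 = X 9 9 := by
    have h := entry 9 1
    simp [Fin.sum_univ_succ, unscaledS] at h
    simp (discharger := decide) only [hT] at h
    refine mul_left_cancel₀ hd ?_
    linear_combination h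
  have h00 : X 0 0 - X 0 2 = X 9 9 := by
    have h := entry 0 9
    simp [Fin.sum_univ_succ, unscaledS] at h
    simp (discharger := decide) only [hT] at h
    refine mul_left_cancel₀ hd ?_
    linear_combination h
  have h22 : X 2 2 - X 2 0 = X 9 9 := by
    have h := entry 2 9
    simp [Fin.sum_univ_succ, unscaledS] at h
    simp (discharger := decide) only [hT] at h
    refine mul_left_cancel₀ hd ?_
    linear_combination -h
  have h42 : X 4 0 = X 4 2 := by
    have h := entry 4 9
    simp [Fin.sum_univ_succ, unscaledS] at h
    simp (discharger := decide) only [hT] at h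
    refine mul_left_cancel₀ hd ?_
    linear_combination h
  have h20 : X 0 0 - X 2 0 = X 9 9 := by
    have h := entry 9 0
    simp [Fin.sum_univ_succ, unscaledS] at h
    simp (discharger := decide) only [hT] at h
    refine mul_left_cancel₀ hd ?_
    linear_combination -h
  have h24 : X 0 4 = X 2 4 := by
    have h := entry 9 4
    simp [Fin.sum_univ_succ, unscaledS] at h
    simp (discharger := decide) only [hT] at h
    refine mul_left_cancel₀ hd ?_
    linear_combination -h
  have h44 : X 4 4 - X 4 0 = X 1 1 + X 3 1 := by
    have h := entry 4 1
    simp [Fin.sum_univ_succ, unscaledS] at h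
    simp (discharger := decide) only [hT] at h
    refine mul_left_cancel₀ hd2 ?_
    linear_combination -h - (1 + dd) * h42
  have h44_symm : X 4 4 - X 0 4 = X 1 1 + X 1 3 := by
    have h := entry 1 4
    simp [Fin.sum_univ_succ, unscaledS] at h
    simp (discharger := decide) only [hT] at h
    refine mul_left_cancel₀ hd2 ?_
    linear_combination h - (1 + dd) * h24
  have h02 : X 0 2 = X 0 4 + X 1 3 := by
    have h := entry 0 1
    simp [Fin.sum_univ_succ, unscaledS] at h
    simp (discharger := decide) only [hT] at h
    refine mul_left_cancel₀ hd2 ?_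
    linear_combination h - h00 + h11 + (1 + dd) * (h11 - h31)
  ext i j
  by_cases hij : eigenBlock i = eigenBlock j
  · clear hS hT entry
    fin_cases i <;> fin_cases j <;> simp [eigenBlock] at hij <;>
      simp [Z1, Z2, Z3, Z4] <;> grind
  · have h1 := hT i j hij
    rw [h1]
    have hz {Z} (hZ : Z ∈ Comm) : Z i j = 0 := ((mem_Comm_iff Z).1 hZ).2 i j hij
    simp [hz Z1_mem_Comm, hz Z2_mem_Comm, hz Z3_mem_Comm, hz Z4_mem_Comm]

lemma linearIndependent_Z : LinearIndependent ℂ ![Z1, Z2, Z3, Z4] := by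
  rw [Fintype.linearIndependent_iff]
  intro g hg
  have entry (i j : Fin 10) :
      g 0 * Z1 i j + g 1 * Z2 i j + g 2 * Z3 i j + g 3 * Z4 i j = 0 := by
    simpa [Fin.sum_univ_succ, add_assoc] using congrFun₂ hg i j
  have h0 := entry 7 7
  have h1 := entry 7 8
  have h2 := entry 1 3
  have h3 := entry 0 4
  simp [Z1, Z2, Z3, Z4] at h0 h1 h2 h3
  intro k
  fin_cases k <;> assumption

/-- Z1, Z2, Z3, Z4 are linearly independent over ℂ and form a basis of {S,T}′. -/
theorem Z_basis_of_commutant :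
    LinearIndependent ℂ ![Z1, Z2, Z3, Z4] ∧
    Submodule.span ℂ {Z1, Z2, Z3, Z4} = Comm := by
  refine ⟨linearIndependent_Z, le_antisymm (Submodule.span_le.2 ?_) fun X hX => ?_⟩
  · rintro _ (rfl | rfl | rfl | rfl)
    exacts [Z1_mem_Comm, Z2_mem_Comm, Z3_mem_Comm, Z4_mem_Comm]
  · rw [eq_combination_of_mem_Comm hX]
    have hspan {Z} (hZ : Z ∈ ({Z1, Z2, Z3, Z4} : Set (Matrix (Fin 10) (Fin 10) ℂ))) (c : ℂ) :
        c • Z ∈ Submodule.span ℂ {Z1, Z2, Z3, Z4} :=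
      Submodule.smul_mem _ c (Submodule.subset_span hZ)
    exact add_mem (add_mem (add_mem (hspan (by simp) _) (hspan (by simp) _))
      (hspan (by simp) _)) (hspan (by simp) _)
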